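/- Let n ≥ 1, a > −1, b > 0, β ≥ 0, and let Ĥ_p(x) (p = 0,…,n) be the Selberg-type integrals Ĥ_p(x) := (1/C(n,p)) ∫_{[0,1]^n} ∏_{r=1}^n t_r^a (1−t_r)^{b−1} e^{−x Σ t_r} ∏_{j<k} |t_k − t_j|^β e_p(1−t_1,…,1−t_n) dt, with B̃_p = p(a + b + 1 + (β/2)(2n − p − 1)), D̃_p = p((β/2)(n − p) + b). Each Ĥ_p is entire in x, with power series Ĥ_p(x) = Σ_{k=0}^∞ c_{p,k} x^k. Let X and Y be the (n+1)×(n+1) matrices (rows and columns indexed by 0,…,n) with X having diagonal entries (−n, −(n−1), …, 0) and superdiagonal entries (n, n−1, …, 1), and Y having diagonal entries (−B̃_0, −B̃_1, …, −B̃_n) and subdiagonal entries (D̃_1, D̃_2, …, D̃_n). Then: (i) the column vector Ĥ(x) = (Ĥ_0(x),…,Ĥ_n(x))ᵀ satisfies x (d/dx)Ĥ(x) = (xX + Y)Ĥ(x); (ii) c_{0,0} = S_n(a, b−1, β) and c_{n,0} = S_n(a, b, β), and c_{n−p,0} = c_{n,0} ∏_{s=1}^p (B̃_{n+1−s}/D̃_{n+1−s})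 for p = 1,…,n; (iii) the coefficient vectors c_k := (c_{0,k},…,c_{n,k})ᵀ satisfy (k I_{n+1} − Y) c_k = X c_{k−1} for all k ≥ 1, where I_{n+1} is the identity matrix. -/

import Mathlib

open Real MeasureTheory Matrix

/-- The Selberg-type correlation integral
`Ĥ_p(x) = (1/C(n,p)) ∫_{[0,1]^n} ∏ t_r^a (1−t_r)^{b−1} e^{−xΣt_r} ∏_{j<k}|t_k−t_j|^β
e_p(1−t_1,…,1−t_n) dt`. -/
noncomputable def selbergH (n : ℕ) (a b β : ℝ) (p : ℕ) (x : ℝ) : ℝ :=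
  (1 / (n.choose p : ℝ)) *
    ∫ t : Fin n → ℝ in Set.univ.pi (fun _ => Set.Icc (0:ℝ) 1),
      (∏ r, (t r) ^ a * (1 - t r) ^ (b - 1)) * Real.exp (-x * ∑ r, t r) *
      (∏ j, ∏ k ∈ Finset.Ioi j, |t k - t j| ^ β) *
      (∑ s ∈ Finset.univ.powersetCard p, ∏ i ∈ s, (1 - t i))

/-- The Selberg integral `S_n(a,b,β) = ∫_{[0,1]^n} ∏ t_r^a (1−t_r)^b ∏_{j<k}|t_k−t_j|^β dt`. -/
noncomputable def selbergIntegral (n : ℕ) (a b β : ℝ) : ℝ :=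
  ∫ t : Fin n → ℝ in Set.univ.pi (fun _ => Set.Icc (0:ℝ) 1),
    (∏ r, (t r) ^ a * (1 - t r) ^ b) *
      ∏ j, ∏ k ∈ Finset.Ioi j, |t k - t j| ^ β

/-- `B̃_p = p(a + b + 1 + (β/2)(2n − p − 1))`. -/
noncomputable def Btil (n : ℕ) (a b β : ℝ) (p : ℕ) : ℝ :=
  p * (a + b + 1 + (β / 2) * (2 * n - p - 1))

/-- `D̃_p = p((β/2)(n − p) + b)`. -/
noncomputable def Dtil (n : ℕ) (b β : ℝ) (p : ℕ) : ℝ :=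
  p * ((β / 2) * ((n : ℝ) - p) + b)

/-- The bidiagonal matrix `X` with diagonal `(−n,−(n−1),…,0)` and superdiagonal
`(n,n−1,…,1)`. -/
noncomputable def matX (n : ℕ) : Matrix (Fin (n + 1)) (Fin (n + 1)) ℝ :=
  Matrix.of fun p q =>
    if (q : ℕ) = (p : ℕ) then -((n : ℝ) - (p : ℕ))
    else if (q : ℕ) = (p : ℕ) + 1 then (n : ℝ) - (p : ℕ) else 0

/-- The bidiagonal matrix `Y` with diagonal `(−B̃_0,…,−B̃_n)` and subdiagonal
`(D̃_1,…,D̃_n)`. -/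
noncomputable def matY (n : ℕ) (a b β : ℝ) : Matrix (Fin (n + 1)) (Fin (n + 1)) ℝ :=
  Matrix.of fun p q =>
    if (q : ℕ) = (p : ℕ) then -(Btil n a b β p)
    else if (q : ℕ) + 1 = (p : ℕ) then Dtil n b β p else 0


noncomputable def sW (n : ℕ) (a b β x : ℝ) (t : Fin n → ℝ) : ℝ :=
  (∏ r, (t r) ^ a * (1 - t r) ^ (b - 1)) * Real.exp (-x * ∑ r, t r) *
      (∏ j, ∏ k ∈ Finset.Ioi j, |t k - t j| ^ β)

def cube (n : ℕ) : Set (Fin n → ℝ) := Set.univ.pi (fun _ => Set.Icc (0:ℝ) 1)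

noncomputable def sF (n : ℕ) (a b β x : ℝ) (S : Finset (Fin n)) : ℝ :=
  ∫ t in cube n, sW n a b β x t * ∏ i ∈ S, (1 - t i)

theorem vprod_eq (n : ℕ) (β : ℝ) (t : Fin n → ℝ) :
    (∏ j, ∏ k ∈ Finset.Ioi j, |t k - t j| ^ β) = |(Matrix.vandermonde t).det| ^ β := by
  rw [Matrix.det_vandermonde, Finset.abs_prod, ← Real.finsetProd_rpow]
  · refine Finset.prod_congr rfl fun j _ => ?_
    rw [Finset.abs_prod, ← Real.finsetProd_rpow]
    intro i _; positivity
  · intro i _; positivity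

theorem sW_perm (n : ℕ) (a b β x : ℝ) (t : Fin n → ℝ) (σ : Equiv.Perm (Fin n)) :
    sW n a b β x (fun i => t (σ i)) = sW n a b β x t := by
  unfold sW
  rw [vprod_eq, vprod_eq]
  have h1 : Matrix.vandermonde (fun i => t (σ i)) = (Matrix.vandermonde t).submatrix σ id := by
    ext i j; simp [Matrix.vandermonde]
  rw [h1, Matrix.det_permute, abs_mul]
  have h2 : |((Equiv.Perm.sign σ : ℤ) : ℝ)| = 1 := by
    rcases Int.units_eq_one_or (Equiv.Perm.sign σ) with h | h <;> simp [h]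
  rw [h2, one_mul, Equiv.prod_comp σ (fun i => t i ^ a * (1 - t i) ^ (b - 1)),
    Equiv.sum_comp σ (fun i => t i)]

theorem measurableSet_cube (n : ℕ) : MeasurableSet (cube n) :=
  MeasurableSet.univ_pi fun _ => measurableSet_Icc

theorem isCompact_cube (n : ℕ) : IsCompact (cube n) :=
  isCompact_univ_pi fun _ => isCompact_Icc

theorem mem_cube {n : ℕ} {t : Fin n → ℝ} : t ∈ cube n ↔ ∀ i, 0 ≤ t i ∧ t i ≤ 1 := by
  unfold cube; rw [Set.mem_univ_pi]; rfl

theorem integral_perm (n : ℕ) (f : (Fin n → ℝ) → ℝ) (σ : Equiv.Perm (Fin n)) :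
    ∫ t in cube n, f (fun i => t (σ i)) = ∫ t in cube n, f t := by
  have h := volume_measurePreserving_piCongrLeft (fun _ : Fin n => ℝ) σ.symm
  have he : ∀ t : Fin n → ℝ, MeasurableEquiv.piCongrLeft (fun _ : Fin n => ℝ) σ.symm t
      = fun i => t (σ i) := by
    intro t
    ext i
    have := MeasurableEquiv.piCongrLeft_apply_apply (β := fun _ : Fin n => ℝ) σ.symm t (σ i)
    simpa using this
  have h2 := h.setIntegral_preimage_emb (MeasurableEquiv.measurableEmbedding _) f (cube n)
  rw [← h2]
  have h3 : (MeasurableEquiv.piCongrLeft (fun _ : Fin n => ℝ) σ.symm) ⁻¹' cube n = cube n := by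
    ext t
    rw [Set.mem_preimage, he, mem_cube, mem_cube]
    exact ⟨fun h i => by simpa using h (σ.symm i), fun h i => h _⟩
  rw [h3]
  simp only [he]

theorem beta_int (a b : ℝ) (ha : -1 < a) (hb : 0 < b) :
    IntegrableOn (fun t : ℝ => t ^ a * (1 - t) ^ (b - 1)) (Set.Icc 0 1) := by
  have h := Complex.betaIntegral_convergent (u := (a + 1 : ℝ)) (v := (b : ℝ)) (by simp; linarith)
    (by simpa using hb)
  rw [intervalIntegrable_iff_integrableOn_Icc_of_le zero_le_one] at h
  refine IntegrableOn.congr_fun h.norm ?_ measurableSet_Icc |>.congr_fun (fun _ _ => rfl)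
    measurableSet_Icc
  intro t ht
  have h1 : ((t:ℂ) ^ (((a + 1 : ℝ) : ℂ) - 1)) = ((t ^ a : ℝ) : ℂ) := by
    rw [Complex.ofReal_cpow ht.1]; simp
  have h2 : ((1 - (t:ℂ)) ^ ((b : ℂ) - 1)) = (((1 - t) ^ (b - 1) : ℝ) : ℂ) := by
    rw [Complex.ofReal_cpow (by linarith [ht.2])]; simp
  simp only []
  rw [h1, h2, ← Complex.ofReal_mul, Complex.norm_real, Real.norm_eq_abs, abs_of_nonneg]
  exact mul_nonneg (Real.rpow_nonneg ht.1 _) (Real.rpow_nonneg (by linarith [ht.2]) _)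

theorem volume_cube (n : ℕ) : (volume : Measure (Fin n → ℝ)).restrict (cube n)
    = Measure.pi (fun _ : Fin n => (volume : Measure ℝ).restrict (Set.Icc 0 1)) := by
  rw [cube, volume_pi, Measure.restrict_pi_pi]

theorem prod_int (n : ℕ) (a b : ℝ) (ha : -1 < a) (hb : 0 < b) :
    IntegrableOn (fun t : Fin n → ℝ => ∏ r, (t r ^ a * (1 - t r) ^ (b - 1))) (cube n) := by
  rw [IntegrableOn, volume_cube]
  exact Integrable.fintype_prod (f := fun _ t => t ^ a * (1 - t) ^ (b - 1))
    (fun _ => beta_int a b ha hb)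

theorem continuous_V (n : ℕ) (β : ℝ) (hβ : 0 ≤ β) :
    Continuous (fun t : Fin n → ℝ => ∏ j, ∏ k ∈ Finset.Ioi j, |t k - t j| ^ β) := by
  refine continuous_finsetProd _ fun j _ => continuous_finsetProd _ fun k _ => ?_
  exact Continuous.rpow_const (by fun_prop) (fun _ => Or.inr hβ)

theorem sW_mul_int (n : ℕ) (a b β x : ℝ) (ha : -1 < a) (hb : 0 < b) (hβ : 0 ≤ β)
    (g : (Fin n → ℝ) → ℝ) (hg : Continuous g) :
    IntegrableOn (fun t => sW n a b β x t * g t) (cube n) := by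
  have h : ContinuousOn (fun t : Fin n → ℝ => Real.exp (-x * ∑ r, t r) *
      (∏ j, ∏ k ∈ Finset.Ioi j, |t k - t j| ^ β) * g t) (cube n) := by
    have := continuous_V n β hβ
    exact (by fun_prop : Continuous _).continuousOn
  have h2 := (prod_int n a b ha hb).mul_continuousOn h (isCompact_cube n)
  refine h2.congr_fun (fun t _ => ?_) (measurableSet_cube n)
  simp only [sW]; ring

theorem sF_perm (n : ℕ) (a b β x : ℝ) (S : Finset (Fin n)) (σ : Equiv.Perm (Fin n)) :
    sF n a b β x (S.map σ.toEmbedding) = sF n a b β x S := by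
  unfold sF
  have := integral_perm n (fun t => sW n a b β x t * ∏ i ∈ S, (1 - t i)) σ
  simp only [sW_perm] at this
  rw [← this]
  simp [Finset.prod_map]

theorem sF_card (n : ℕ) (a b β x : ℝ) (S S' : Finset (Fin n)) (h : S.card = S'.card) :
    sF n a b β x S = sF n a b β x S' := by
  let e := Finset.equivOfCardEq h
  let σ : Equiv.Perm (Fin n) := e.extendSubtype
  have h1 : S.map σ.toEmbedding = S' := by
    apply Finset.eq_of_subset_of_card_le
    · intro y hy
      rw [Finset.mem_map] at hy
      obtain ⟨i, hi, rfl⟩ := hy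
      exact e.extendSubtype_mem i hi
    · simp [h]
  rw [← h1, sF_perm]

theorem selbergH_eq (n : ℕ) (a b β x : ℝ) (ha : -1 < a) (hb : 0 < b) (hβ : 0 ≤ β)
    (S : Finset (Fin n)) :
    selbergH n a b β S.card x = sF n a b β x S := by
  unfold selbergH
  have h1 : ∫ t : Fin n → ℝ in Set.univ.pi (fun _ => Set.Icc (0:ℝ) 1),
      (∏ r, (t r) ^ a * (1 - t r) ^ (b - 1)) * Real.exp (-x * ∑ r, t r) *
      (∏ j, ∏ k ∈ Finset.Ioi j, |t k - t j| ^ β) *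
      (∑ s ∈ Finset.univ.powersetCard S.card, ∏ i ∈ s, (1 - t i))
      = ∑ s ∈ (Finset.univ : Finset (Fin n)).powersetCard S.card, sF n a b β x s := by
    simp only [sF]
    rw [← integral_finsetSum]
    · refine integral_congr_ae (Filter.Eventually.of_forall fun t => ?_)
      simp only [sW, Finset.mul_sum]
    · intro s _
      exact sW_mul_int n a b β x ha hb hβ _ (by fun_prop)
  rw [h1, Finset.sum_congr rfl (fun s hs => sF_card n a b β x s S
    (Finset.mem_powersetCard.1 hs).2), Finset.sum_const, Finset.card_powersetCard]
  have : (n.choose S.card : ℝ) ≠ 0 := by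
    have : S.card ≤ n := by simpa using Finset.card_le_univ S
    exact_mod_cast (Nat.choose_pos this).ne'
  simp only [Finset.card_univ, Fintype.card_fin, nsmul_eq_mul]
  field_simp

theorem sF_hasDerivAt (n : ℕ) (a b β x : ℝ) (ha : -1 < a) (hb : 0 < b) (hβ : 0 ≤ β)
    (S : Finset (Fin n)) :
    HasDerivAt (fun y => sF n a b β y S)
      (∫ t in cube n, sW n a b β x t * ((-∑ r, t r) * ∏ i ∈ S, (1 - t i))) x := by
  unfold sF
  have hsh : ∀ (y : ℝ) (t : Fin n → ℝ),
      sW n a b β y t = sW n a b β x t * Real.exp ((x - y) * ∑ r, t r) := by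
    intro y t
    unfold sW
    have : Real.exp (-y * ∑ r, t r) = Real.exp (-x * ∑ r, t r) * Real.exp ((x - y) * ∑ r, t r) := by
      rw [← Real.exp_add]; ring_nf
    rw [this]; ring
  refine (hasDerivAt_integral_of_dominated_loc_of_deriv_le
    (F := fun y t => sW n a b β y t * ∏ i ∈ S, (1 - t i))
    (F' := fun y t => sW n a b β y t * ((-∑ r, t r) * ∏ i ∈ S, (1 - t i)))
    (bound := fun t => ‖sW n a b β x t * (Real.exp (∑ r, t r) *
      ((∑ r, t r) * ∏ i ∈ S, (1 - t i)))‖) (Metric.ball_mem_nhds x one_pos) ?_ ?_ ?_ ?_ ?_ ?_).2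
  · exact Filter.Eventually.of_forall fun y =>
      (sW_mul_int n a b β y ha hb hβ _ (by fun_prop)).aestronglyMeasurable
  · exact sW_mul_int n a b β x ha hb hβ _ (by fun_prop)
  · exact (sW_mul_int n a b β x ha hb hβ _ (by fun_prop)).aestronglyMeasurable
  · refine (ae_restrict_iff' (measurableSet_cube n)).2 (Filter.Eventually.of_forall ?_)
    intro t ht y hy
    rw [mem_cube] at ht
    have h0 : 0 ≤ ∑ r, t r := Finset.sum_nonneg fun i _ => (ht i).1
    rw [Metric.mem_ball, Real.dist_eq, abs_lt] at hy
    rw [hsh y t, mul_assoc, norm_mul, norm_mul, norm_mul, norm_mul, norm_mul, norm_mul, norm_neg]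
    gcongr
    rw [Real.norm_eq_abs, Real.norm_eq_abs, Real.abs_exp, Real.abs_exp]
    apply Real.exp_le_exp.2
    nlinarith
  · exact (sW_mul_int n a b β x ha hb hβ _ (by fun_prop)).norm
  · refine Filter.Eventually.of_forall fun t y _ => ?_
    unfold sW
    have h1 : HasDerivAt (fun y : ℝ => Real.exp (-y * ∑ r, t r))
        (Real.exp (-y * ∑ r, t r) * (-1 * ∑ r, t r)) y :=
      (((hasDerivAt_id y).neg).mul_const (∑ r, t r)).exp
    refine (((h1.const_mul (∏ r, (t r) ^ a * (1 - t r) ^ (b - 1))).mul_const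
      (∏ j, ∏ k ∈ Finset.Ioi j, |t k - t j| ^ β)).mul_const (∏ i ∈ S, (1 - t i))).congr_deriv ?_
    ring

theorem k_int (β : ℝ) (hβ : 0 < β) :
    IntegrableOn (fun v : ℝ => |v| ^ β / v) (Set.Icc (-1) 1) := by
  have h1 : IntervalIntegrable (fun v : ℝ => |v| ^ β / v) volume 0 1 := by
    have := intervalIntegral.intervalIntegrable_rpow' (a := 0) (b := 1) (r := β - 1) (by linarith)
    refine this.congr ?_
    intro v hv
    rw [Set.uIoc_of_le zero_le_one] at hv
    simp only []
    rw [abs_of_pos hv.1, Real.rpow_sub_one hv.1.ne']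
  have h2 : IntervalIntegrable (fun v : ℝ => |v| ^ β / v) volume (-1) 0 := by
    rw [IntervalIntegrable.iff_comp_neg]
    simp only [neg_neg, neg_zero, abs_neg, div_neg]
    exact h1.symm.neg
  exact (intervalIntegrable_iff_integrableOn_Icc_of_le (by norm_num)).1 (h2.trans h1)

theorem cube_prod (m : ℕ) : (MeasurableEquiv.piFinSuccAbove (fun _ : Fin (m+1) => ℝ) 0) ⁻¹'
    (Set.Icc (0:ℝ) 1 ×ˢ cube m) = cube (m+1) := by
  ext t
  rw [Set.mem_preimage, mem_cube, Set.mem_prod, mem_cube]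
  simp [MeasurableEquiv.piFinSuccAbove, Fin.forall_fin_succ, Fin.insertNthEquiv, Fin.tail]

theorem int_split (m : ℕ) (g : ℝ × (Fin m → ℝ) → ℝ) :
    IntegrableOn (fun t : Fin (m+1) → ℝ => g (t 0, fun i => t i.succ)) (cube (m+1)) ↔
    IntegrableOn g (Set.Icc (0:ℝ) 1 ×ˢ cube m) (volume.prod volume) := by
  have h := volume_preserving_piFinSuccAbove (fun _ : Fin (m+1) => ℝ) 0
  rw [← cube_prod]
  exact h.integrableOn_comp_preimage (MeasurableEquiv.measurableEmbedding _) (f := g)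

theorem integral_split (m : ℕ) (g : ℝ × (Fin m → ℝ) → ℝ) :
    ∫ t : Fin (m+1) → ℝ in cube (m+1), g (t 0, fun i => t i.succ) =
    ∫ z in (Set.Icc (0:ℝ) 1 ×ˢ cube m), g z ∂(volume.prod volume) := by
  have h := volume_preserving_piFinSuccAbove (fun _ : Fin (m+1) => ℝ) 0
  rw [← cube_prod]
  exact h.setIntegral_preimage_emb (MeasurableEquiv.measurableEmbedding _) g _

theorem sing_base (m : ℕ) (Q : (Fin m → ℝ) → ℝ) (β : ℝ) (hQ : IntegrableOn Q (cube m))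
    (hβ : 0 < β) (j : Fin m) :
    IntegrableOn (fun t : Fin (m+1) → ℝ => |t j.succ - t 0| ^ β / (t 0 - t j.succ) *
      Q (fun i => t i.succ)) (cube (m+1)) := by
  have := int_split m (fun z => |z.2 j - z.1| ^ β / (z.1 - z.2 j) * Q z.2)
  rw [this]
  set k : ℝ → ℝ := (Set.Icc (-1) 1).indicator (fun v : ℝ => |v| ^ β / v) with hk
  have hki : Integrable k := (integrable_indicator_iff measurableSet_Icc).2 (k_int β hβ)
  have hkm : Measurable k := by
    apply Measurable.indicator _ measurableSet_Icc
    fun_prop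
  set R : (Fin m → ℝ) → ℝ := (cube m).indicator Q with hR
  have hRi : Integrable R := (integrable_indicator_iff (measurableSet_cube m)).2 hQ
  have hmain : Integrable (fun z : ℝ × (Fin m → ℝ) => k (z.1 - z.2 j) * R z.2)
      (volume.prod volume) := by
    rw [integrable_prod_iff']
    · constructor
      · refine Filter.Eventually.of_forall fun s => ?_
        exact (hki.comp_sub_right (s j)).mul_const (R s)
      · simp only [norm_mul, integral_mul_const]
        have : ∀ s : Fin m → ℝ, ∫ u, ‖k (u - s j)‖ = ∫ u, ‖k u‖ := fun s =>
          integral_sub_right_eq_self (fun u => ‖k u‖) (s j)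
        simp only [this]
        exact hRi.norm.const_mul _
    · refine AEStronglyMeasurable.mul ?_ ?_
      · exact (hkm.comp (by fun_prop)).aestronglyMeasurable
      · exact hRi.aestronglyMeasurable.comp_snd
  refine hmain.integrableOn.congr_fun ?_ (measurableSet_Icc.prod (measurableSet_cube m))
  rintro ⟨u, s⟩ ⟨hu, hs⟩
  have hs' := mem_cube.1 hs j
  simp only [hk, hR] at hu hs ⊢
  rw [Set.indicator_of_mem hs, Set.indicator_of_mem, abs_sub_comm]
  constructor <;> linarith [hu.1, hu.2]

noncomputable def sG (m : ℕ) (a b β x u : ℝ) (s : Fin m → ℝ) : ℝ :=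
  u ^ (a + 1) * (1 - u) ^ b * Real.exp (-x * u) * ∏ k, |s k - u| ^ β

theorem sW_cons (m : ℕ) (a b β x : ℝ) (ha : -1 < a) (hb : 0 < b) (t : Fin (m+1) → ℝ)
    (h0 : 0 ≤ t 0) (h1 : t 0 ≤ 1) :
    sW (m+1) a b β x t * (t 0 * (1 - t 0)) =
      sG m a b β x (t 0) (fun i => t i.succ) * sW m a b β x (fun i => t i.succ) := by
  unfold sW sG
  rw [Real.rpow_add_one' h0 (by linarith)]
  have e1 : (1 - t 0) ^ b = (1 - t 0) ^ (b - 1) * (1 - t 0) := by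
    rw [← Real.rpow_add_one' (by linarith) (by linarith)]; ring_nf
  rw [e1, Fin.prod_univ_succ, Fin.sum_univ_succ, Fin.prod_univ_succ]
  rw [Fin.prod_Ioi_zero (f := fun k => |t k - t 0| ^ β)]
  have e2 : ∀ j : Fin m, ∏ k ∈ Finset.Ioi j.succ, |t k - t j.succ| ^ β =
      ∏ k ∈ Finset.Ioi j, |t k.succ - t j.succ| ^ β := fun j =>
    Fin.prod_Ioi_succ (fun k => |t k - t j.succ| ^ β) j
  simp only [e2]
  have e3 : Real.exp (-x * (t 0 + ∑ i : Fin m, t i.succ)) =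
      Real.exp (-x * t 0) * Real.exp (-x * ∑ i : Fin m, t i.succ) := by
    rw [← Real.exp_add]; ring_nf
  rw [e3]; ring

theorem sG_cont (m : ℕ) (a b β x : ℝ) (ha : -1 < a) (hb : 0 < b) (hβ : 0 ≤ β) (s : Fin m → ℝ) :
    Continuous (fun u => sG m a b β x u s) := by
  unfold sG
  refine Continuous.mul (Continuous.mul (Continuous.mul ?_ ?_) (by fun_prop)) ?_
  · exact Continuous.rpow_const (by fun_prop) (fun _ => Or.inr (by linarith))
  · exact Continuous.rpow_const (by fun_prop) (fun _ => Or.inr (by linarith))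
  · exact continuous_finsetProd _ fun k _ =>
      Continuous.rpow_const (by fun_prop) (fun _ => Or.inr (by linarith))

theorem hasDerivAt_logprod {ι : Type*} (T : Finset ι) (f : ι → ℝ → ℝ) (c : ι → ℝ) (u : ℝ)
    (h : ∀ i ∈ T, HasDerivAt (f i) (f i u * c i) u) :
    HasDerivAt (fun v => ∏ i ∈ T, f i v) ((∏ i ∈ T, f i u) * ∑ i ∈ T, c i) u := by
  classical
  induction T using Finset.induction_on with
  | empty => simpa using hasDerivAt_const u (1:ℝ)
  | insert i T hi ih =>
    have h1 := h i (Finset.mem_insert_self _ _)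
    have h2 := ih fun k hk => h k (Finset.mem_insert_of_mem hk)
    simp only [Finset.prod_insert hi, Finset.sum_insert hi]
    refine (h1.fun_mul h2).congr_deriv ?_
    ring

theorem sG_deriv (m : ℕ) (a b β x u : ℝ) (s : Fin m → ℝ) (h0 : 0 < u) (h1 : u < 1)
    (hs : ∀ k, u ≠ s k) :
    HasDerivAt (fun u => sG m a b β x u s)
      (sG m a b β x u s * ((a + 1) / u - b / (1 - u) - x + ∑ k, β / (u - s k))) u := by
  unfold sG
  have d1 : HasDerivAt (fun u : ℝ => u ^ (a + 1)) (u ^ (a + 1) * ((a + 1) / u)) u := by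
    refine (Real.hasDerivAt_rpow_const (x := u) (p := a + 1) (Or.inl h0.ne')).congr_deriv ?_
    rw [Real.rpow_sub_one h0.ne']; ring
  have h1' : 1 - u ≠ 0 := by linarith
  have d2 : HasDerivAt (fun u : ℝ => (1 - u) ^ b) ((1 - u) ^ b * (-(b / (1 - u)))) u := by
    refine (((hasDerivAt_id' u).const_sub 1).rpow_const (p := b) (Or.inl h1')).congr_deriv ?_
    rw [Real.rpow_sub_one h1']; ring
  have d3 : HasDerivAt (fun u : ℝ => Real.exp (-x * u)) (Real.exp (-x * u) * (-x)) u := by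
    refine (((hasDerivAt_id' u).const_mul (-x)).exp).congr_deriv ?_
    ring
  have d4 := hasDerivAt_logprod Finset.univ (fun k (u : ℝ) => |s k - u| ^ β)
    (fun k => β / (u - s k)) u (by
      intro k _
      have hne : s k - u ≠ 0 := sub_ne_zero.2 (hs k).symm
      have hne' : u - s k ≠ 0 := sub_ne_zero.2 (hs k)
      have h3 : HasDerivAt (fun v : ℝ => |s k - v|) ((SignType.sign (s k - u) : ℝ) * (-1)) u :=
        (hasDerivAt_abs hne).comp u ((hasDerivAt_id' u).const_sub (s k))
      refine (h3.rpow_const (p := β) (Or.inl (abs_ne_zero.2 hne))).congr_deriv ?_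
      rw [Real.rpow_sub_one (abs_ne_zero.2 hne)]
      rcases lt_or_gt_of_ne hne with h | h
      · rw [abs_of_neg h]; simp [sign_neg h]; field_simp
      · rw [abs_of_pos h]; simp [sign_pos h]; field_simp; ring)
  refine (((d1.fun_mul d2).fun_mul d3).fun_mul d4).congr_deriv ?_
  ring

theorem sing_int (m : ℕ) (a b β x : ℝ) (ha : -1 < a) (hb : 0 < b) (hβ : 0 ≤ β)
    (g : (Fin (m+1) → ℝ) → ℝ) (hg : Continuous g) (j : Fin m) :
    IntegrableOn (fun t => β * (sW (m+1) a b β x t *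
      (g t * (t 0 * (1 - t 0)) / (t 0 - t j.succ)))) (cube (m+1)) := by
  rcases hβ.eq_or_lt with h | hpos
  · subst h; simp
  have hbase := sing_base m _ β (prod_int m a b ha hb) hpos j
  have hC : Continuous (fun t : Fin (m+1) → ℝ => β * g t * ((t 0) ^ (a+1) * (1 - t 0) ^ b *
      Real.exp (-x * t 0) * ∏ k ∈ Finset.univ.erase j, |t (Fin.succ k) - t 0| ^ β) *
      (Real.exp (-x * ∑ r : Fin m, t r.succ) *
        ∏ j : Fin m, ∏ k ∈ Finset.Ioi j, |t k.succ - t j.succ| ^ β)) := by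
    have c1 : Continuous (fun t : Fin (m+1) → ℝ => (t 0) ^ (a+1)) :=
      Continuous.rpow_const (by fun_prop) (fun _ => Or.inr (by linarith))
    have c2 : Continuous (fun t : Fin (m+1) → ℝ => (1 - t 0) ^ b) :=
      Continuous.rpow_const (by fun_prop) (fun _ => Or.inr (by linarith))
    have c3 : Continuous (fun t : Fin (m+1) → ℝ =>
        ∏ k ∈ Finset.univ.erase j, |t (Fin.succ k) - t 0| ^ β) :=
      continuous_finsetProd _ fun k _ =>
        Continuous.rpow_const (by fun_prop) (fun _ => Or.inr hβ)
    have c4 : Continuous (fun t : Fin (m+1) → ℝ =>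
        ∏ j : Fin m, ∏ k ∈ Finset.Ioi j, |t k.succ - t j.succ| ^ β) :=
      (continuous_V m β hβ).comp (by fun_prop : Continuous fun (t : Fin (m+1) → ℝ) (i : Fin m) =>
        t i.succ)
    fun_prop
  refine (hbase.mul_continuousOn hC.continuousOn (isCompact_cube _)).congr_fun ?_
    (measurableSet_cube _)
  intro t ht
  have ht0 := mem_cube.1 ht 0
  have e : β * (sW (m+1) a b β x t * (g t * (t 0 * (1 - t 0)) / (t 0 - t j.succ))) =
      β * g t / (t 0 - t j.succ) * (sW (m+1) a b β x t * (t 0 * (1 - t 0))) := by ring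
  simp only []
  rw [e, sW_cons m a b β x ha hb t ht0.1 ht0.2]
  unfold sG sW
  rw [← Finset.mul_prod_erase Finset.univ (fun k : Fin m => |t k.succ - t 0| ^ β)
    (Finset.mem_univ j)]
  ring

noncomputable def dI (m : ℕ) (a b β x : ℝ) (T : Finset (Fin m)) (t : Fin (m+1) → ℝ) : ℝ :=
  sW (m+1) a b β x t * ((∏ i ∈ T, (1 - t i.succ)) *
    ((a + b + 1) * (1 - t 0) - b - x * (t 0 * (1 - t 0)))) +
  ∑ j : Fin m, β * (sW (m+1) a b β x t *
      ((∏ i ∈ T, (1 - t i.succ)) * (t 0 * (1 - t 0)) / (t 0 - t j.succ)))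

theorem dI_int (m : ℕ) (a b β x : ℝ) (ha : -1 < a) (hb : 0 < b) (hβ : 0 ≤ β)
    (T : Finset (Fin m)) : IntegrableOn (dI m a b β x T) (cube (m+1)) := by
  refine Integrable.add ?_ ?_
  · exact sW_mul_int _ a b β x ha hb hβ _ (by fun_prop)
  · exact integrable_finsetSum _ fun j _ => sing_int m a b β x ha hb hβ _ (by fun_prop) j

theorem dI_integral (m : ℕ) (a b β x : ℝ) (ha : -1 < a) (hb : 0 < b) (hβ : 0 ≤ β)
    (T : Finset (Fin m)) : ∫ t in cube (m+1), dI m a b β x T t = 0 := by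
  have hcons : ∀ t : Fin (m+1) → ℝ, Fin.cons (t 0) (fun i : Fin m => t i.succ) = t := fun t =>
    Fin.cons_self_tail t
  let g : ℝ × (Fin m → ℝ) → ℝ := fun z => dI m a b β x T (Fin.cons z.1 z.2)
  have hi : IntegrableOn g (Set.Icc (0:ℝ) 1 ×ˢ cube m) (volume.prod volume) := by
    rw [← int_split]
    simp only [g, hcons]
    exact dI_int m a b β x ha hb hβ T
  have h1 := integral_split m g
  simp only [g, hcons] at h1
  rw [h1]
  change ∫ z in (Set.Icc (0:ℝ) 1 ×ˢ cube m), g z ∂(volume.prod volume) = 0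
  rw [IntegrableOn, ← Measure.prod_restrict] at hi
  rw [← Measure.prod_restrict, integral_prod_symm _ hi]
  refine integral_eq_zero_of_ae ?_
  filter_upwards [hi.prod_left_ae] with s hs
  have hII : IntervalIntegrable (fun u => g (u, s)) volume 0 1 :=
    (intervalIntegrable_iff_integrableOn_Icc_of_le zero_le_one).2 hs
  have hft := MeasureTheory.integral_eq_of_hasDerivAt_off_countable_of_le
    (fun u => sG m a b β x u s * (sW m a b β x s * ∏ i ∈ T, (1 - s i))) (fun u => g (u, s))
    zero_le_one (s := Set.range s) (Set.countable_range s)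
    ((sG_cont m a b β x ha hb hβ s).mul_const _).continuousOn ?_ hII
  · rw [Pi.zero_apply, integral_Icc_eq_integral_Ioc, ← intervalIntegral.integral_of_le zero_le_one,
      hft]
    have z1 : sG m a b β x 1 s = 0 := by
      simp [sG, Real.zero_rpow hb.ne']
    have z0 : sG m a b β x 0 s = 0 := by
      simp [sG, Real.zero_rpow (show a + 1 ≠ 0 by linarith)]
    rw [z0, z1]; ring
  · rintro u ⟨⟨hu0, hu1⟩, hus⟩
    have hne : ∀ k, u ≠ s k := fun k h => hus ⟨k, h.symm⟩
    refine ((sG_deriv m a b β x u s hu0 hu1 hne).mul_const _).congr_deriv ?_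
    have hw := sW_cons m a b β x ha hb (Fin.cons u s : Fin (m+1) → ℝ) (by simpa using hu0.le)
      (by simpa using hu1.le)
    simp only [Fin.cons_zero, Fin.cons_succ] at hw
    have hu0' : u ≠ 0 := hu0.ne'
    have hu1' : 1 - u ≠ 0 := by linarith
    simp only [g, dI, Fin.cons_zero, Fin.cons_succ]
    have e : ∑ j : Fin m, β * (sW (m+1) a b β x (Fin.cons u s : Fin (m+1) → ℝ) *
      ((∏ i ∈ T, (1 - s i)) * (u * (1 - u)) / (u - s j))) =
      (sW (m+1) a b β x (Fin.cons u s : Fin (m+1) → ℝ) * (u * (1 - u))) * (∏ i ∈ T, (1 - s i)) *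
        ∑ k, β / (u - s k) := by
      rw [Finset.mul_sum]
      refine Finset.sum_congr rfl fun k _ => ?_
      ring
    rw [e]
    have e2 : sG m a b β x u s * ((a + 1) / u - b / (1 - u) - x + ∑ k, β / (u - s k)) *
        (sW m a b β x s * ∏ i ∈ T, (1 - s i)) =
        (sG m a b β x u s * sW m a b β x s) * ((a + 1) / u - b / (1 - u) - x + ∑ k, β / (u - s k)) *
        (∏ i ∈ T, (1 - s i)) := by ring
    rw [e2, ← hw]
    field_simp
    ring

theorem sW_diag (n : ℕ) (a b β x : ℝ) (t : Fin n → ℝ) (i j : Fin n) (hij : i ≠ j) (h : t i = t j) :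
    β * sW n a b β x t = 0 := by
  by_cases hb : β = 0
  · simp [hb]
  have : (Matrix.vandermonde t).det = 0 := by
    by_contra hne
    exact hij (Matrix.det_vandermonde_ne_zero_iff.1 hne h)
  unfold sW
  rw [vprod_eq, this, abs_zero, Real.zero_rpow hb]; ring

/-- symmetrisation under the exchange of `0` and `j.succ` -/
theorem symm_int (m : ℕ) (a b β x : ℝ) (ha : -1 < a) (hb : 0 < b) (hβ : 0 ≤ β)
    (g h : (Fin (m+1) → ℝ) → ℝ) (hg : Continuous g) (j : Fin m)
    (hh : ∀ t : Fin (m+1) → ℝ, g t * (t 0 * (1 - t 0)) -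
      g (fun i => t (Equiv.swap 0 j.succ i)) * (t j.succ * (1 - t j.succ))
      = (t 0 - t j.succ) * h t) :
    2 * ∫ t in cube (m+1), β * (sW (m+1) a b β x t *
      (g t * (t 0 * (1 - t 0)) / (t 0 - t j.succ))) =
    β * ∫ t in cube (m+1), sW (m+1) a b β x t * h t := by
  have hi := sing_int m a b β x ha hb hβ g hg j
  have h1 := integral_perm (m+1) (fun t => β * (sW (m+1) a b β x t *
      (g t * (t 0 * (1 - t 0)) / (t 0 - t j.succ)))) (Equiv.swap 0 j.succ)
  simp only [sW_perm, Equiv.swap_apply_left, Equiv.swap_apply_right] at h1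
  have hi2 : IntegrableOn (fun t => β * (sW (m+1) a b β x t *
      (g (fun i => t (Equiv.swap 0 j.succ i)) * (t j.succ * (1 - t j.succ)) / (t j.succ - t 0))))
      (cube (m+1)) := by
    have hm := (volume_measurePreserving_piCongrLeft (fun _ : Fin (m+1) => ℝ)
      (Equiv.swap 0 j.succ))
    have he : ∀ t : Fin (m+1) → ℝ, MeasurableEquiv.piCongrLeft (fun _ : Fin (m+1) => ℝ)
        (Equiv.swap 0 j.succ) t = fun i => t (Equiv.swap 0 j.succ i) := by
      intro t
      ext i
      have := MeasurableEquiv.piCongrLeft_apply_apply (β := fun _ : Fin (m+1) => ℝ)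
        (Equiv.swap 0 j.succ) t (Equiv.swap 0 j.succ i)
      simpa using this
    have h3 : (MeasurableEquiv.piCongrLeft (fun _ : Fin (m+1) => ℝ) (Equiv.swap 0 j.succ)) ⁻¹'
        cube (m+1) = cube (m+1) := by
      ext t
      rw [Set.mem_preimage, he, mem_cube, mem_cube]
      exact ⟨fun h i => by simpa using h (Equiv.swap 0 j.succ i), fun h i => h _⟩
    have h4 := (hm.integrableOn_comp_preimage (MeasurableEquiv.measurableEmbedding _)).2 hi
    rw [h3] at h4
    refine h4.congr_fun (fun t _ => ?_) (measurableSet_cube _)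
    simp only [Function.comp, he, sW_perm, Equiv.swap_apply_left, Equiv.swap_apply_right]
  rw [two_mul]
  nth_rewrite 2 [← h1]
  rw [← integral_add hi hi2, ← integral_const_mul]
  refine integral_congr_ae (Filter.Eventually.of_forall fun t => ?_)
  simp only []
  by_cases hd : t 0 = t j.succ
  · have := sW_diag (m+1) a b β x t 0 j.succ (Fin.succ_ne_zero j).symm hd
    have e1 : ∀ y, β * (sW (m+1) a b β x t * y) = 0 := fun y => by
      rw [← mul_assoc, this, zero_mul]
    rw [e1, e1, e1, add_zero]
  · have hd1 : t 0 - t j.succ ≠ 0 := sub_ne_zero.2 hd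
    have e : h t = (g t * (t 0 * (1 - t 0)) -
      g (fun i => t (Equiv.swap 0 j.succ i)) * (t j.succ * (1 - t j.succ))) / (t 0 - t j.succ) := by
      rw [hh]; field_simp
    rw [e, ← neg_sub (t 0) (t j.succ), div_neg]
    ring

noncomputable def sQ (n : ℕ) (a b β x : ℝ) (S : Finset (Fin n)) (r : Fin n) : ℝ :=
  ∫ t in cube n, sW n a b β x t * ((1 - t r) * ∏ i ∈ S, (1 - t i))

theorem sQ_eq (n : ℕ) (a b β x : ℝ) (S : Finset (Fin n)) (r q : Fin n) (hr : r ∈ S) (hq : q ∈ S) :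
    sQ n a b β x S r = sQ n a b β x S q := by
  unfold sQ
  rw [← integral_perm n _ (Equiv.swap r q)]
  simp only [sW_perm, Equiv.swap_apply_left]
  refine integral_congr_ae (Filter.Eventually.of_forall fun t => ?_)
  simp only []
  congr 2
  refine Finset.prod_equiv (Equiv.swap r q) (fun i => ?_) (fun i _ => rfl)
  by_cases h1 : i = r
  · subst h1; simp [hr, hq]
  by_cases h2 : i = q
  · subst h2; simp [hr, hq]
  rw [Equiv.swap_apply_of_ne_of_ne h1 h2]

theorem selbergH_deriv (n : ℕ) (a b β x : ℝ) (ha : -1 < a) (hb : 0 < b) (hβ : 0 ≤ β)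
    (S : Finset (Fin n)) :
    HasDerivAt (selbergH n a b β S.card)
      (-(n:ℝ) * selbergH n a b β S.card x +
        ((n:ℝ) - S.card) * selbergH n a b β (S.card + 1) x + ∑ r ∈ S, sQ n a b β x S r) x := by
  have hf : selbergH n a b β S.card = fun y => sF n a b β y S :=
    funext fun y => selbergH_eq n a b β y ha hb hβ S
  have key : (∫ t in cube n, sW n a b β x t * ((-∑ r, t r) * ∏ i ∈ S, (1 - t i))) =
      -(n:ℝ) * sF n a b β x S + ∑ r, sQ n a b β x S r := by
    unfold sF sQ
    rw [← integral_finsetSum, ← integral_const_mul, ← integral_add]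
    · refine integral_congr_ae (Filter.Eventually.of_forall fun t => ?_)
      simp only []
      rw [← Finset.mul_sum, ← Finset.sum_mul, Finset.sum_sub_distrib]
      simp
      ring
    · exact (sW_mul_int n a b β x ha hb hβ _ (by fun_prop)).const_mul _
    · exact integrable_finsetSum _ fun r _ => sW_mul_int n a b β x ha hb hβ _ (by fun_prop)
    · exact fun r _ => sW_mul_int n a b β x ha hb hβ _ (by fun_prop)
  have h2 : ∑ r ∈ Sᶜ, sQ n a b β x S r = ((n:ℝ) - S.card) * selbergH n a b β (S.card + 1) x := by
    rw [Finset.sum_congr rfl (g := fun _ => selbergH n a b β (S.card + 1) x), Finset.sum_const,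
      Finset.card_compl, nsmul_eq_mul, Fintype.card_fin, Nat.cast_sub]
    · simpa using Finset.card_le_univ S
    · intro r hr
      have hr' : r ∉ S := Finset.mem_compl.1 hr
      rw [← Finset.card_insert_of_notMem hr', selbergH_eq n a b β x ha hb hβ]
      unfold sQ sF
      simp only [Finset.prod_insert hr']
  have h3 := sF_hasDerivAt n a b β x ha hb hβ S
  rw [key, ← Finset.sum_add_sum_compl S, h2, ← selbergH_eq n a b β x ha hb hβ, ← hf] at h3
  refine h3.congr_deriv ?_
  ring

theorem ibp_identity (m : ℕ) (a b β x : ℝ) (ha : -1 < a) (hb : 0 < b) (hβ : 0 ≤ β)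
    (T : Finset (Fin m)) :
    (a + b + 1) * selbergH (m+1) a b β (T.card + 1) x - b * selbergH (m+1) a b β T.card x
      - x * (selbergH (m+1) a b β (T.card + 1) x -
        sQ (m+1) a b β x (insert 0 (T.map (Fin.succEmb m))) 0)
      + (T.card * (β / 2 * selbergH (m+1) a b β (T.card + 1) x)
        + ((m:ℝ) - T.card) * (β / 2 * (2 * selbergH (m+1) a b β (T.card + 1) x
          - selbergH (m+1) a b β T.card x))) = 0 := by
  have hn0 : (0 : Fin (m+1)) ∉ T.map (Fin.succEmb m) := by simp
  have H0 : selbergH (m+1) a b β T.card x =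
      ∫ t in cube (m+1), sW (m+1) a b β x t * ∏ i ∈ T, (1 - t i.succ) := by
    have := selbergH_eq (m+1) a b β x ha hb hβ (T.map (Fin.succEmb m))
    rw [Finset.card_map] at this
    rw [this]; unfold sF; simp only [Finset.prod_map, Fin.coe_succEmb]
  have H1 : selbergH (m+1) a b β (T.card+1) x =
      ∫ t in cube (m+1), sW (m+1) a b β x t * ((1 - t 0) * ∏ i ∈ T, (1 - t i.succ)) := by
    have := selbergH_eq (m+1) a b β x ha hb hβ (insert 0 (T.map (Fin.succEmb m)))
    rw [Finset.card_insert_of_notMem hn0, Finset.card_map] at this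
    rw [this]; unfold sF; simp only [Finset.prod_insert hn0, Finset.prod_map, Fin.coe_succEmb]
  have H2 : ∀ j ∉ T, selbergH (m+1) a b β (T.card+1) x =
      ∫ t in cube (m+1), sW (m+1) a b β x t * ((1 - t j.succ) * ∏ i ∈ T, (1 - t i.succ)) := by
    intro j hj
    have := selbergH_eq (m+1) a b β x ha hb hβ ((insert j T).map (Fin.succEmb m))
    rw [Finset.card_map, Finset.card_insert_of_notMem hj] at this
    rw [this]; unfold sF; simp only [Finset.prod_map, Finset.prod_insert hj, Fin.coe_succEmb]
  have HQ : sQ (m+1) a b β x (insert 0 (T.map (Fin.succEmb m))) 0 =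
      ∫ t in cube (m+1), sW (m+1) a b β x t *
        ((1 - t 0) * ((1 - t 0) * ∏ i ∈ T, (1 - t i.succ))) := by
    unfold sQ; simp only [Finset.prod_insert hn0, Finset.prod_map, Fin.coe_succEmb]
  have hI := dI_integral m a b β x ha hb hβ T
  unfold dI at hI
  rw [integral_add (sW_mul_int _ a b β x ha hb hβ _ (by fun_prop))
    (integrable_finsetSum _ fun j _ => sing_int m a b β x ha hb hβ _ (by fun_prop) j),
    integral_finsetSum _ fun j _ => sing_int m a b β x ha hb hβ _ (by fun_prop) j] at hI
  have hA : (∫ t in cube (m+1), sW (m+1) a b β x t * ((∏ i ∈ T, (1 - t i.succ)) *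
      ((a + b + 1) * (1 - t 0) - b - x * (t 0 * (1 - t 0))))) =
      (a + b + 1) * selbergH (m+1) a b β (T.card + 1) x - b * selbergH (m+1) a b β T.card x
      - x * (selbergH (m+1) a b β (T.card + 1) x -
        sQ (m+1) a b β x (insert 0 (T.map (Fin.succEmb m))) 0) := by
    have i0 := sW_mul_int (m+1) a b β x ha hb hβ (fun t => ∏ i ∈ T, (1 - t i.succ)) (by fun_prop)
    have i1 := sW_mul_int (m+1) a b β x ha hb hβ
      (fun t => (1 - t 0) * ∏ i ∈ T, (1 - t i.succ)) (by fun_prop)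
    have i2 := sW_mul_int (m+1) a b β x ha hb hβ
      (fun t => (1 - t 0) * ((1 - t 0) * ∏ i ∈ T, (1 - t i.succ))) (by fun_prop)
    rw [H0, H1, HQ, ← integral_sub i1 i2, ← integral_const_mul, ← integral_const_mul,
      ← integral_const_mul, ← integral_sub (i1.const_mul _) (i0.const_mul _), ← integral_sub]
    rotate_left
    · exact (i1.const_mul _).sub (i0.const_mul _)
    · exact (i1.sub i2).const_mul _
    refine integral_congr_ae (Filter.Eventually.of_forall fun t => ?_)
    simp only []
    ring
  have hB1 : ∀ j ∈ T, (∫ t in cube (m+1), β * (sW (m+1) a b β x t *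
      ((∏ i ∈ T, (1 - t i.succ)) * (t 0 * (1 - t 0)) / (t 0 - t j.succ)))) =
      β / 2 * selbergH (m+1) a b β (T.card + 1) x := by
    intro j hj
    have := symm_int m a b β x ha hb hβ (fun t => ∏ i ∈ T, (1 - t i.succ))
      (fun t => (1 - t 0) * ∏ i ∈ T, (1 - t i.succ)) (by fun_prop) j (by
        intro t
        simp only []
        rw [← Finset.mul_prod_erase T _ hj, ← Finset.mul_prod_erase T _ hj,
          Equiv.swap_apply_right]
        have : ∏ i ∈ T.erase j, (1 - t (Equiv.swap 0 j.succ i.succ)) =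
            ∏ i ∈ T.erase j, (1 - t i.succ) := by
          refine Finset.prod_congr rfl fun i hi => ?_
          rw [Equiv.swap_apply_of_ne_of_ne (Fin.succ_ne_zero i)
            (fun h => (Finset.mem_erase.1 hi).1 (Fin.succ_injective _ h))]
        rw [this]; ring)
    rw [← H1] at this
    linarith
  have hB2 : ∀ j ∈ Tᶜ, (∫ t in cube (m+1), β * (sW (m+1) a b β x t *
      ((∏ i ∈ T, (1 - t i.succ)) * (t 0 * (1 - t 0)) / (t 0 - t j.succ)))) =
      β / 2 * (2 * selbergH (m+1) a b β (T.card + 1) x - selbergH (m+1) a b β T.card x) := by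
    intro j hj
    have hj' : j ∉ T := Finset.mem_compl.1 hj
    have := symm_int m a b β x ha hb hβ (fun t => ∏ i ∈ T, (1 - t i.succ))
      (fun t => (1 - t 0 - t j.succ) * ∏ i ∈ T, (1 - t i.succ)) (by fun_prop) j (by
        intro t
        simp only []
        have : ∏ i ∈ T, (1 - t (Equiv.swap 0 j.succ i.succ)) =
            ∏ i ∈ T, (1 - t i.succ) := by
          refine Finset.prod_congr rfl fun i hi => ?_
          rw [Equiv.swap_apply_of_ne_of_ne (Fin.succ_ne_zero i)
            (fun h => hj' ((Fin.succ_injective _ h : i = j) ▸ hi))]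
        rw [this]; ring)
    have i0 := sW_mul_int (m+1) a b β x ha hb hβ (fun t => ∏ i ∈ T, (1 - t i.succ)) (by fun_prop)
    have i1 := sW_mul_int (m+1) a b β x ha hb hβ
      (fun t => (1 - t 0) * ∏ i ∈ T, (1 - t i.succ)) (by fun_prop)
    have i2 := sW_mul_int (m+1) a b β x ha hb hβ
      (fun t => (1 - t j.succ) * ∏ i ∈ T, (1 - t i.succ)) (by fun_prop)
    have e : (∫ t in cube (m+1), sW (m+1) a b β x t *
        ((1 - t 0 - t j.succ) * ∏ i ∈ T, (1 - t i.succ))) =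
        selbergH (m+1) a b β (T.card + 1) x + selbergH (m+1) a b β (T.card + 1) x
          - selbergH (m+1) a b β T.card x := by
      nth_rewrite 2 [H2 j hj']
      rw [H1, H0, ← integral_add i1 i2, ← integral_sub]
      rotate_left
      · exact i1.add i2
      · exact i0
      refine integral_congr_ae (Filter.Eventually.of_forall fun t => ?_)
      simp only []
      ring
    rw [e] at this
    linarith
  rw [hA, ← Finset.sum_add_sum_compl T, Finset.sum_congr rfl hB1, Finset.sum_congr rfl hB2,
    Finset.sum_const, Finset.sum_const, Finset.card_compl, nsmul_eq_mul, nsmul_eq_mul,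
    Fintype.card_fin, Nat.cast_sub (by simpa using Finset.card_le_univ T)] at hI
  linarith

theorem selberg_ode (n : ℕ) (a b β x : ℝ) (ha : -1 < a) (hb : 0 < b) (hβ : 0 ≤ β)
    (p : ℕ) (hp : p ≤ n) :
    x * deriv (selbergH n a b β p) x =
      x * (-((n:ℝ) - p) * selbergH n a b β p x + ((n:ℝ) - p) * selbergH n a b β (p+1) x)
      - Btil n a b β p * selbergH n a b β p x + Dtil n b β p * selbergH n a b β (p-1) x := by
  rcases p with _ | p
  · have h := selbergH_deriv n a b β x ha hb hβ ∅
    simp only [Finset.card_empty, Finset.sum_empty] at h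
    rw [h.deriv]
    simp [Btil, Dtil]
  obtain ⟨m, rfl⟩ : ∃ m, n = m + 1 := ⟨n - 1, by omega⟩
  obtain ⟨T, -, hT⟩ := Finset.exists_subset_card_eq
    (s := (Finset.univ : Finset (Fin m))) (n := p) (by simp; omega)
  subst hT
  have hn0 : (0 : Fin (m+1)) ∉ T.map (Fin.succEmb m) := by simp
  have hS : (insert 0 (T.map (Fin.succEmb m))).card = T.card + 1 := by
    rw [Finset.card_insert_of_notMem hn0, Finset.card_map]
  have h := selbergH_deriv (m+1) a b β x ha hb hβ (insert 0 (T.map (Fin.succEmb m)))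
  have hq : ∑ r ∈ insert 0 (T.map (Fin.succEmb m)),
      sQ (m+1) a b β x (insert 0 (T.map (Fin.succEmb m))) r =
      ((T.card : ℝ) + 1) * sQ (m+1) a b β x (insert 0 (T.map (Fin.succEmb m))) 0 := by
    rw [Finset.sum_congr rfl (fun r hr => sQ_eq (m+1) a b β x _ r 0 hr
      (Finset.mem_insert_self _ _)), Finset.sum_const, hS, nsmul_eq_mul]
    push_cast; ring
  rw [hq, hS] at h
  rw [h.deriv]
  have hi := ibp_identity m a b β x ha hb hβ T
  simp only [Btil, Dtil, Nat.add_sub_cancel]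
  push_cast
  linear_combination ((T.card : ℝ) + 1) * hi

theorem hasSum_of_eq_fun (f g : ℕ → ℝ) (s : ℝ) (hg : HasSum g s) (h : ∀ k, f k = g k) :
    HasSum f s := by
  rw [show f = g from funext h]; exact hg

theorem hasSum_mul_deriv (c : ℕ → ℝ) (f : ℝ → ℝ)
    (hf : ∀ x, HasSum (fun k => c k * x ^ k) (f x)) :
    ∀ᶠ x in nhds (0:ℝ), HasSum (fun k : ℕ => (k * c k) * x ^ k) (x * deriv f x) := by
  have h1 : HasFPowerSeriesAt f (FormalMultilinearSeries.ofScalars ℝ c) 0 := by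
    rw [hasFPowerSeriesAt_iff]
    refine Filter.Eventually.of_forall fun z => ?_
    simpa [FormalMultilinearSeries.coeff_ofScalars, mul_comm] using hf z
  obtain ⟨r, hr⟩ := h1
  have h2 := hr.fderiv.hasFPowerSeriesAt
  rw [hasFPowerSeriesAt_iff] at h2
  filter_upwards [h2] with x hx
  have h3 := (ContinuousLinearMap.apply ℝ ℝ (1:ℝ)).hasSum hx
  simp only [ContinuousLinearMap.apply_apply, zero_add, map_smul,
    FormalMultilinearSeries.derivSeries_coeff_one, FormalMultilinearSeries.coeff_ofScalars,
    fderiv_apply_one_eq_deriv] at h3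
  have h4 := h3.mul_left x
  have h5 := (hasSum_nat_add_iff (f := fun k : ℕ => ((k:ℝ) * c k) * x ^ k) 1
    (g := x * deriv f x)).1 (by
      refine hasSum_of_eq_fun _ _ _ h4 fun k => ?_
      simp only [smul_eq_mul, nsmul_eq_mul]
      push_cast
      ring)
  simpa using h5

theorem hasSum_shift (c : ℕ → ℝ) (s x : ℝ) (hf : HasSum (fun k => c k * x ^ k) s) :
    HasSum (fun k : ℕ => (if k = 0 then 0 else c (k - 1)) * x ^ k) (x * s) := by
  have h5 := (hasSum_nat_add_iff (f := fun k : ℕ => (if k = 0 then 0 else c (k - 1)) * x ^ k) 1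
    (g := x * s)).1 (by
      refine hasSum_of_eq_fun _ _ _ (hf.mul_left x) fun k => ?_
      simp only [Nat.add_eq_zero_iff, one_ne_zero, and_false, if_false, Nat.add_sub_cancel, pow_succ]
      ring)
  simpa using h5

theorem coeff_zero_of_hasSum (d : ℕ → ℝ)
    (h : ∀ᶠ x in nhds (0:ℝ), HasSum (fun k => d k * x ^ k) 0) (k : ℕ) : d k = 0 := by
  have h1 : HasFPowerSeriesAt (0 : ℝ → ℝ) (FormalMultilinearSeries.ofScalars ℝ d) 0 := by
    rw [hasFPowerSeriesAt_iff]
    filter_upwards [h] with z hz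
    simpa [FormalMultilinearSeries.coeff_ofScalars, mul_comm] using hz
  have h2 := h1.eq_zero
  rw [FormalMultilinearSeries.ofScalars_series_eq_zero] at h2
  exact congrFun h2 k

theorem recurrence_of_ode (n : ℕ) (X Y : Matrix (Fin n) (Fin n) ℝ) (c : Fin n → ℕ → ℝ)
    (f : Fin n → ℝ → ℝ) (hc : ∀ p x, HasSum (fun k => c p k * x ^ k) (f p x))
    (ho : ∀ x, (fun p => x * deriv (f p) x) = (x • X + Y).mulVec (fun p => f p x))
    (k : ℕ) (hk : 1 ≤ k) :
    ((k : ℝ) • (1 : Matrix (Fin n) (Fin n) ℝ) - Y).mulVec (fun p => c p k)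
      = X.mulVec (fun p => c p (k - 1)) := by
  ext p
  have key : ∀ k : ℕ, (k * c p k - ∑ q, Y p q * c q k -
      ∑ q, X p q * (if k = 0 then 0 else c q (k - 1))) = 0 := by
    apply coeff_zero_of_hasSum
    filter_upwards [hasSum_mul_deriv (c p) (f p) (hc p)] with x hx
    have h1 : HasSum (fun k => ∑ q, Y p q * (c q k * x ^ k)) (∑ q, Y p q * f q x) :=
      hasSum_sum fun q _ => (hc q x).mul_left _
    have h2 : HasSum (fun k : ℕ => ∑ q, X p q * ((if k = 0 then 0 else c q (k - 1)) * x ^ k))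
        (∑ q, X p q * (x * f q x)) :=
      hasSum_sum fun q _ => (hasSum_shift _ _ _ (hc q x)).mul_left _
    have h3 := (hx.sub h1).sub h2
    have e := congrFun (ho x) p
    simp only [Matrix.mulVec, dotProduct, Matrix.add_apply, Matrix.smul_apply, smul_eq_mul] at e
    have e2 : x * deriv (f p) x - ∑ q, Y p q * f q x - ∑ q, X p q * (x * f q x) = 0 := by
      rw [e, sub_sub, ← Finset.sum_add_distrib, sub_eq_zero]
      exact Finset.sum_congr rfl fun q _ => by ring
    rw [e2] at h3
    refine hasSum_of_eq_fun _ _ _ h3 fun k => ?_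
    simp only [sub_mul, Finset.sum_mul, mul_assoc]
  have := key k
  rw [Matrix.sub_mulVec, Matrix.smul_mulVec, Matrix.one_mulVec]
  simp only [Pi.sub_apply, Pi.smul_apply, smul_eq_mul, Matrix.mulVec, dotProduct]
  simp only [if_neg (show k ≠ 0 by omega)] at this
  linarith

theorem ode_matrix (n : ℕ) (a b β : ℝ) (ha : -1 < a) (hb : 0 < b) (hβ : 0 ≤ β) (x : ℝ) :
      (fun p : Fin (n + 1) => x * deriv (selbergH n a b β (p : ℕ)) x)
        = (x • matX n + matY n a b β).mulVec
            (fun p : Fin (n + 1) => selbergH n a b β (p : ℕ) x) := by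
  ext ⟨p, hp⟩
  have hp' : p ≤ n := by omega
  simp only [Matrix.mulVec, dotProduct, Matrix.add_apply, Matrix.smul_apply, smul_eq_mul, matX, matY,
    Matrix.of_apply]
  rw [selberg_ode n a b β x ha hb hβ p hp']
  set h : ℕ → ℝ := fun q => selbergH n a b β q x with hh
  have hs : ∀ q : Fin (n+1), (x * (if (q : ℕ) = p then -((n : ℝ) - p)
      else if (q : ℕ) = p + 1 then (n : ℝ) - p else 0) +
      (if (q : ℕ) = p then -(Btil n a b β p)
      else if (q : ℕ) + 1 = p then Dtil n b β p else 0)) * selbergH n a b β (q : ℕ) x =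
      (fun q : ℕ => (if q = p then (-x * ((n:ℝ) - p) - Btil n a b β p) * h q else 0) +
      (if q = p + 1 then x * ((n:ℝ) - p) * h q else 0) +
      (if q = p - 1 then Dtil n b β p * h q else 0)) q := by
    intro q
    simp only []
    have hD0 : p = 0 → Dtil n b β p = 0 := fun h => by simp [Dtil, h]
    rcases Nat.eq_zero_or_pos p with h0 | h0
    · rw [hD0 h0]
      split_ifs <;> first | omega | ring
    · split_ifs <;> first | omega | ring
  rw [Finset.sum_congr rfl (fun q _ => hs q), Fin.sum_univ_eq_sum_range (fun q : ℕ =>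
      (if q = p then (-x * ((n:ℝ) - p) - Btil n a b β p) * h q else 0) +
      (if q = p + 1 then x * ((n:ℝ) - p) * h q else 0) +
      (if q = p - 1 then Dtil n b β p * h q else 0)) (n+1), Finset.sum_add_distrib,
      Finset.sum_add_distrib, Finset.sum_ite_eq', Finset.sum_ite_eq', Finset.sum_ite_eq',
      if_pos (Finset.mem_range.2 hp), if_pos (Finset.mem_range.2 (show p - 1 < n + 1 by omega))]
  have e : (if p + 1 ∈ Finset.range (n + 1) then x * ((n:ℝ) - p) * h (p+1) else 0) =
      x * ((n:ℝ) - p) * h (p+1) := by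
    split_ifs with hm
    · rfl
    · have : p = n := by rw [Finset.mem_range] at hm; omega
      rw [this]; ring
  rw [e]
  simp only [hh]
  ring
/-- The matrix linear differential equation `x Ĥ′(x) = (xX + Y)Ĥ(x)` for the vector of
Selberg correlation integrals, together with the initial coefficients and the vector
recurrence `(kI − Y)c_k = Xc_{k−1}` for the power series coefficients. -/
theorem selbergH_matrix_ODE_and_recurrence (n : ℕ) (hn : 1 ≤ n)
    (a b β : ℝ) (ha : -1 < a) (hb : 0 < b) (hβ : 0 ≤ β)
    (c : Fin (n + 1) → ℕ → ℝ)
    (hc : ∀ (p : Fin (n + 1)) (x : ℝ),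
      HasSum (fun k : ℕ => c p k * x ^ k) (selbergH n a b β p x)) :
    -- (i) the matrix differential equation
    (∀ x : ℝ,
      (fun p : Fin (n + 1) => x * deriv (selbergH n a b β (p : ℕ)) x)
        = (x • matX n + matY n a b β).mulVec
            (fun p : Fin (n + 1) => selbergH n a b β (p : ℕ) x))
    -- (ii) initial coefficients
    ∧ c 0 0 = selbergIntegral n a (b - 1) β
    ∧ c (Fin.last n) 0 = selbergIntegral n a b β
    ∧ (∀ p : ℕ, 1 ≤ p → p ≤ n →
        c ⟨n - p, by omega⟩ 0
          = c (Fin.last n) 0 *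
              ∏ s ∈ Finset.Icc 1 p, (Btil n a b β (n + 1 - s) / Dtil n b β (n + 1 - s)))
    -- (iii) the vector recurrence
    ∧ (∀ k : ℕ, 1 ≤ k →
        ((k : ℝ) • (1 : Matrix (Fin (n + 1)) (Fin (n + 1)) ℝ) - matY n a b β).mulVec
            (fun p : Fin (n + 1) => c p k)
          = (matX n).mulVec (fun p : Fin (n + 1) => c p (k - 1))) := by
  have hode := ode_matrix n a b β ha hb hβ
  have hc0 : ∀ p : Fin (n + 1), c p 0 = selbergH n a b β p 0 := by
    intro p
    have h1 := hc p 0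
    have h2 : HasSum (fun k : ℕ => c p k * (0:ℝ) ^ k) (c p 0) := by
      have := hasSum_single (f := fun k : ℕ => c p k * (0:ℝ) ^ k) 0 (by
        intro k hk; simp [hk])
      simpa using this
    exact h2.unique h1
  refine ⟨hode, ?_, ?_, ?_, ?_⟩
  · rw [hc0]
    simp [selbergH, selbergIntegral]
  · rw [hc0]
    unfold selbergH selbergIntegral
    simp only [Fin.val_last, Nat.choose_self, Nat.cast_one, div_one, one_mul]
    refine setIntegral_congr_fun (MeasurableSet.univ_pi fun _ => measurableSet_Icc) ?_
    intro t ht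
    have ht' : ∀ i, 0 ≤ t i ∧ t i ≤ 1 := mem_cube.1 ht
    have hps : (Finset.univ : Finset (Fin n)).powersetCard n = {Finset.univ} := by
      have := Finset.powersetCard_self (Finset.univ : Finset (Fin n))
      rwa [Finset.card_univ, Fintype.card_fin] at this
    simp only [neg_zero, zero_mul, Real.exp_zero, mul_one]
    rw [hps, Finset.sum_singleton]
    have e : ∀ r, t r ^ a * (1 - t r) ^ b = t r ^ a * (1 - t r) ^ (b - 1) * (1 - t r) := by
      intro r
      have := Real.rpow_add_one' (x := 1 - t r) (y := b - 1) (by linarith [(ht' r).2])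
        (by linarith)
      rw [mul_assoc, ← this, sub_add_cancel]
    simp only [e]
    rw [Finset.prod_mul_distrib (f := fun r => t r ^ a * (1 - t r) ^ (b - 1))]
    ring
  · have hstep : ∀ q : ℕ, 1 ≤ q → q ≤ n → selbergH n a b β (q - 1) 0 =
        selbergH n a b β q 0 * (Btil n a b β q / Dtil n b β q) := by
      intro q h1 h2
      have := selberg_ode n a b β 0 ha hb hβ q h2
      have hq : (0:ℝ) < q := by exact_mod_cast h1
      have hqn : (q:ℝ) ≤ n := by exact_mod_cast h2
      have hD : 0 < Dtil n b β q := by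
        unfold Dtil
        have : 0 ≤ (β / 2) * ((n : ℝ) - q) := mul_nonneg (by linarith) (by linarith)
        exact mul_pos hq (by linarith)
      field_simp
      linarith
    have hall : ∀ p : ℕ, p ≤ n → selbergH n a b β (n - p) 0 = selbergH n a b β n 0 *
        ∏ s ∈ Finset.Icc 1 p, (Btil n a b β (n + 1 - s) / Dtil n b β (n + 1 - s)) := by
      intro p
      induction p with
      | zero => intro _; simp
      | succ p ih =>
        intro hp
        rw [Finset.prod_Icc_succ_top (by omega), ← mul_assoc, ← ih (by omega)]
        have := hstep (n - p) (by omega) (by omega)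
        rw [show n - (p + 1) = n - p - 1 by omega, this, show n + 1 - (p + 1) = n - p by omega]
    intro p _ hp
    rw [hc0, hc0]
    exact hall p hp
  · intro k hk
    exact recurrence_of_ode (n+1) (matX n) (matY n a b β) c (fun p => selbergH n a b β (p:ℕ)) hc
      hode k hk
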